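/- Let d ≥ 2, let S be a countable Abelian group, A ⊂ S a finite set with |A| = n ≥ 1, and q : S → [0,∞) with ‖q‖_{(d+1)/2} ≤ f_{d,n}(r) for some r > 0, where f_{d,n}(r) = (r - r^d)/(r^{d+1}+n)^{d/(d+1)}. Then for every x₀ ∈ ℓ^{d+1}(A^c) with x₀ ≥ 0 and ‖x₀‖_{d+1} ≤ r, and every x₁ : A → [λ_d, 1], the function F(x₀) := ((𝟙_{{0}}+q) * (x₀^d ⊔ x₁^d))|_{A^c} satisfies F(x₀) ≥ 0 and ‖F(x₀)‖_{d+1} ≤ r. -/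

import Mathlib

open scoped ENNReal in
/-- Minkowski's inequality for sums in `ℝ≥0∞`. -/
theorem ENNReal.Lp_add_le_tsum {ι : Type*} {p : ℝ} (hp : 1 ≤ p) (f g : ι → ℝ≥0∞) :
    (∑' i, (f i + g i) ^ p) ^ (1 / p) ≤
      (∑' i, f i ^ p) ^ (1 / p) + (∑' i, g i ^ p) ^ (1 / p) := by
  let _ : MeasurableSpace ι := ⊤
  simpa [MeasureTheory.lintegral_count] using
    ENNReal.lintegral_Lp_add_le (μ := MeasureTheory.Measure.count)
      measurable_from_top.aemeasurable measurable_from_top.aemeasurable hp (f := f) (g := g)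

open scoped ENNReal in
/-- Hölder's inequality for the sum of a product of three functions. -/
theorem ENNReal.tsum_mul_mul_rpow_le {ι : Type*} {s t u : ℝ} (hs : 0 ≤ s) (ht : 0 ≤ t)
    (hu : 0 ≤ u) (hstu : s + t + u = 1) (f g h : ι → ℝ≥0∞) :
    ∑' i, f i ^ s * g i ^ t * h i ^ u ≤
      (∑' i, f i) ^ s * (∑' i, g i) ^ t * (∑' i, h i) ^ u := by
  let _ : MeasurableSpace ι := ⊤
  have H := ENNReal.lintegral_prod_norm_pow_le (μ := MeasureTheory.Measure.count)
    Finset.univ (f := ![f, g, h]) (p := ![s, t, u])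
    (fun _ _ => measurable_from_top.aemeasurable)
    (by simpa [Fin.sum_univ_three] using hstu)
    (by intro i _; fin_cases i <;> simpa)
  simpa [Fin.prod_univ_three, MeasureTheory.lintegral_count] using H

open scoped ENNReal in
/-- Young's convolution inequality on a discrete Abelian group, for functions valued in `ℝ≥0∞`. -/
theorem ENNReal.tsum_conv_rpow_le {S : Type*} [AddCommGroup S] {a b p : ℝ} (ha : 0 < a)
    (hb : 0 < b) (hap : a ≤ p) (hbp : b ≤ p) (h : 1 / a + 1 / b = 1 + 1 / p)
    (f g : S → ℝ≥0∞) :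
    (∑' i, (∑' j, f (i - j) * g j) ^ p) ^ (1 / p) ≤
      (∑' i, f i ^ a) ^ (1 / a) * (∑' i, g i ^ b) ^ (1 / b) := by
  have hp : 0 < p := ha.trans_le hap
  set F := ∑' i, f i ^ a
  set G := ∑' i, g i ^ b
  set t := 1 / a - 1 / p with ht_def
  set u := 1 / b - 1 / p with hu_def
  have ht : 0 ≤ t := sub_nonneg.2 (one_div_le_one_div_of_le ha hap)
  have hu : 0 ≤ u := sub_nonneg.2 (one_div_le_one_div_of_le hb hbp)
  have hs : 0 ≤ 1 / p := by positivity
  have hta : 1 / p + t = 1 / a := by ring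
  have hub : 1 / p + u = 1 / b := by ring
  have hF (i : S) : ∑' j, f (i - j) ^ a = F :=
    (Equiv.subLeft i).tsum_eq fun k => f k ^ a
  have hF' (j : S) : ∑' i, f (i - j) ^ a = F :=
    (Equiv.subRight j).tsum_eq fun k => f k ^ a
  have pointwise (i : S) : (∑' j, f (i - j) * g j) ^ p ≤
      (∑' j, f (i - j) ^ a * g j ^ b) * (F ^ t * G ^ u) ^ p := by
    calc (∑' j, f (i - j) * g j) ^ p
        = (∑' j, (f (i - j) ^ a * g j ^ b) ^ (1 / p) * (f (i - j) ^ a) ^ t *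
            (g j ^ b) ^ u) ^ p := by
          congr 1
          refine tsum_congr fun j => ?_
          calc f (i - j) * g j
              = ((f (i - j) ^ a) ^ (1 / p + t)) * ((g j ^ b) ^ (1 / p + u)) := by
                rw [hta, hub, ← ENNReal.rpow_mul, ← ENNReal.rpow_mul, mul_one_div_cancel ha.ne',
                  mul_one_div_cancel hb.ne', ENNReal.rpow_one, ENNReal.rpow_one]
            _ = _ := by
                rw [ENNReal.mul_rpow_of_nonneg _ _ hs, ENNReal.rpow_add_of_nonneg _ _ hs ht,
                  ENNReal.rpow_add_of_nonneg _ _ hs hu]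
                ring
      _ ≤ ((∑' j, f (i - j) ^ a * g j ^ b) ^ (1 / p) * F ^ t * G ^ u) ^ p := by
          gcongr
          rw [← hF i]
          exact ENNReal.tsum_mul_mul_rpow_le hs ht hu (by linarith) _ _ _
      _ = _ := by
          rw [mul_assoc, ENNReal.mul_rpow_of_nonneg _ _ hp.le, ← ENNReal.rpow_mul,
            one_div_mul_cancel hp.ne', ENNReal.rpow_one]
  have total : ∑' i, ∑' j, f (i - j) ^ a * g j ^ b = F * G := by
    rw [ENNReal.tsum_comm]
    simp_rw [ENNReal.tsum_mul_right, hF', ENNReal.tsum_mul_left]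
    rfl
  calc (∑' i, (∑' j, f (i - j) * g j) ^ p) ^ (1 / p)
      ≤ (F * G * (F ^ t * G ^ u) ^ p) ^ (1 / p) := by
        gcongr
        rw [← total, ← ENNReal.tsum_mul_right]
        exact ENNReal.tsum_le_tsum pointwise
    _ = F ^ (1 / p) * G ^ (1 / p) * (F ^ t * G ^ u) := by
        rw [ENNReal.mul_rpow_of_nonneg _ _ hs, ENNReal.mul_rpow_of_nonneg _ _ hs,
          ← ENNReal.rpow_mul, mul_one_div_cancel hp.ne', ENNReal.rpow_one]
    _ = F ^ (1 / a) * G ^ (1 / b) := by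
        rw [← hta, ← hub, ENNReal.rpow_add_of_nonneg _ _ hs ht, ENNReal.rpow_add_of_nonneg _ _ hs hu]
        ring

open scoped ENNReal in
theorem ENNReal.tsum_pow_le_pow_tsum {ι : Type*} {d : ℕ} (hd : d ≠ 0) (f : ι → ℝ≥0∞) :
    ∑' i, f i ^ d ≤ (∑' i, f i) ^ d := by
  obtain ⟨m, rfl⟩ := Nat.exists_eq_succ_of_ne_zero hd
  rw [Nat.succ_eq_add_one, pow_succ, ← ENNReal.tsum_mul_left]
  refine ENNReal.tsum_le_tsum fun i => ?_
  rw [pow_succ]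
  gcongr
  exact ENNReal.le_tsum i

/-- No summability is needed: a divergent real sum is `0`. -/
theorem ENNReal.ofReal_tsum_le {ι : Type*} {f : ι → ℝ} (hf : ∀ i, 0 ≤ f i) :
    ENNReal.ofReal (∑' i, f i) ≤ ∑' i, ENNReal.ofReal (f i) := by
  by_cases h : Summable f
  · exact (ENNReal.ofReal_tsum_of_nonneg hf h).le
  · simp [tsum_eq_zero_of_not_summable h]

open scoped ENNReal in
/-- `‖F(x₀)‖_{d+1} ≤ ‖x₀‖_{d+1}^d + ‖q‖_{(d+1)/2} ‖z‖_{d+1}^d`, where `x₀ ^ d + q * z ^ d`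
is the convolution form of the map. -/
theorem ENNReal.tsum_pow_add_conv_rpow_le {S : Type*} [AddCommGroup S] {d : ℕ} (hd : 2 ≤ d)
    (f x z : S → ℝ≥0∞) :
    (∑' i, (x i ^ d + ∑' j, f (i - j) * z j ^ d) ^ (d + 1)) ^ (1 / ((d : ℝ) + 1)) ≤
      ((∑' i, x i ^ (d + 1)) ^ (1 / ((d : ℝ) + 1))) ^ d +
      (∑' i, f i ^ (((d : ℝ) + 1) / 2)) ^ (2 / ((d : ℝ) + 1)) *
        (∑' i, z i ^ (d + 1)) ^ ((d : ℝ) / ((d : ℝ) + 1)) := by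
  have hd' : (2 : ℝ) ≤ d := by exact_mod_cast hd
  have minkowski := ENNReal.Lp_add_le_tsum (p := (d : ℝ) + 1) (by linarith)
    (fun i => x i ^ d) (fun i => ∑' j, f (i - j) * z j ^ d)
  have young := ENNReal.tsum_conv_rpow_le (a := ((d : ℝ) + 1) / 2) (b := ((d : ℝ) + 1) / d)
    (p := (d : ℝ) + 1) (by positivity) (by positivity) (by linarith)
    (div_le_self (by positivity) (by linarith)) (by field_simp; ring) f (fun j => z j ^ d)
  have hz (j : S) : (z j ^ d) ^ (((d : ℝ) + 1) / d) = z j ^ (d + 1) := by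
    rw [← ENNReal.rpow_natCast, ← ENNReal.rpow_mul, mul_div_cancel₀ _ (by positivity),
      ← ENNReal.rpow_natCast]
    push_cast
    rfl
  simp_rw [hz, one_div_div] at young
  have hpow (y : ℝ≥0∞) : y ^ ((d : ℝ) + 1) = y ^ (d + 1) := by
    rw [← ENNReal.rpow_natCast]
    push_cast
    rfl
  simp_rw [hpow] at minkowski young
  refine minkowski.trans (add_le_add ?_ young)
  rw [← ENNReal.rpow_natCast (_ ^ _), ← ENNReal.rpow_mul, mul_comm, ENNReal.rpow_mul,
    ENNReal.rpow_natCast]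
  gcongr
  simp_rw [← pow_mul, mul_comm d, pow_mul]
  exact ENNReal.tsum_pow_le_pow_tsum (by omega) _


/-- The map `F_{x₁}(x₀) = (Q * (x₀^d ⊔ x₁^d))|_{A^c}`, with `Q = 𝟙₀ + q`, maps the
`r`-ball of nonnegative functions in `ℓ^{d+1}(A^c)` to itself, provided
`‖q‖_{(d+1)/2} ≤ f_{d,n}(r)` and `x₁` takes values in `[λ_d, 1]` on `A`. -/
theorem selfmap_property {S : Type*} [AddCommGroup S] [Countable S] [DecidableEq S]
    (d : ℕ) (hd : 2 ≤ d) (A : Finset S) (n : ℕ) (hcard : A.card = n) (hn : 1 ≤ n)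
    (q : S → ℝ) (hq0 : ∀ i, 0 ≤ q i)
    (hqsum : Summable fun i => q i ^ (((d : ℝ) + 1) / 2))
    (r : ℝ) (hr : 0 < r)
    (hqle : (∑' i, q i ^ (((d : ℝ) + 1) / 2)) ^ ((2 : ℝ) / ((d : ℝ) + 1)) ≤
      (r - r ^ d) / (r ^ (d + 1) + (n : ℝ)) ^ ((d : ℝ) / ((d : ℝ) + 1)))
    (x₀ : S → ℝ) (hx₀A : ∀ i ∈ A, x₀ i = 0) (hx₀0 : ∀ i, 0 ≤ x₀ i)
    (hx₀sum : Summable fun i => x₀ i ^ (d + 1))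
    (hx₀r : (∑' i, x₀ i ^ (d + 1)) ^ ((1 : ℝ) / ((d : ℝ) + 1)) ≤ r)
    (x₁ : S → ℝ)
    (hx₁ : ∀ i ∈ A, x₁ i ∈ Set.Icc ((d : ℝ) ^ (-(1 : ℝ) / ((d : ℝ) - 1))) 1) :
    let z : S → ℝ := fun i => if i ∈ A then x₁ i else x₀ i
    let Q : S → ℝ := fun i => (if i = 0 then 1 else 0) + q i
    let F : S → ℝ := fun i => if i ∈ A then 0 else ∑' j, Q (i - j) * z j ^ d
    (∀ i, 0 ≤ F i) ∧ Summable (fun i => F i ^ (d + 1)) ∧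
      (∑' i, F i ^ (d + 1)) ^ ((1 : ℝ) / ((d : ℝ) + 1)) ≤ r := by
  intro z Q F
  have hd' : (2 : ℝ) ≤ d := by exact_mod_cast hd
  have hp : (0 : ℝ) < (d : ℝ) + 1 := by positivity
  have hz0 (i : S) : 0 ≤ z i := by
    by_cases hi : i ∈ A
    · simpa [z, hi] using (Real.rpow_nonneg (Nat.cast_nonneg d) _).trans (hx₁ i hi).1
    · simpa [z, hi] using hx₀0 i
  have hQ0 (i : S) : 0 ≤ Q i := add_nonneg (by split_ifs <;> norm_num) (hq0 i)
  have hQz0 (i j : S) : 0 ≤ Q (i - j) * z j ^ d := mul_nonneg (hQ0 _) (pow_nonneg (hz0 _) _)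
  have hF0 (i : S) : 0 ≤ F i := by
    by_cases hi : i ∈ A
    · simp [F, hi]
    · simpa [F, hi] using tsum_nonneg (hQz0 i)
  have hFle (i : S) : ENNReal.ofReal (F i) ≤ ENNReal.ofReal (x₀ i) ^ d +
      ∑' j, ENNReal.ofReal (q (i - j)) * ENNReal.ofReal (z j) ^ d := by
    by_cases hi : i ∈ A
    · simp [F, hi]
    have hterm (j : S) : ENNReal.ofReal (Q (i - j) * z j ^ d) =
        (if j = i then ENNReal.ofReal (z j) ^ d else 0) +
          ENNReal.ofReal (q (i - j)) * ENNReal.ofReal (z j) ^ d := by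
      rw [ENNReal.ofReal_mul (hQ0 _), ENNReal.ofReal_pow (hz0 j),
        ENNReal.ofReal_add (by split_ifs <;> norm_num) (hq0 _), add_mul]
      congr 1
      by_cases hij : j = i
      · simp [hij]
      · simp [hij, sub_eq_zero, Ne.symm hij]
    calc ENNReal.ofReal (F i) ≤ ∑' j, ENNReal.ofReal (Q (i - j) * z j ^ d) := by
          simpa [F, hi] using ENNReal.ofReal_tsum_le (hQz0 i)
      _ = _ := by
          simp_rw [hterm]
          rw [ENNReal.tsum_add, tsum_ite_eq]
          simp [z, hi]
  have hrd : 0 ≤ r - r ^ d := by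
    have hlhs : 0 ≤ (∑' i, q i ^ (((d : ℝ) + 1) / 2)) ^ ((2 : ℝ) / ((d : ℝ) + 1)) :=
      Real.rpow_nonneg (tsum_nonneg fun i => Real.rpow_nonneg (hq0 i) _) _
    have hden : 0 < (r ^ (d + 1) + (n : ℝ)) ^ ((d : ℝ) / ((d : ℝ) + 1)) := by positivity
    simpa using (le_div_iff₀ hden).1 (hlhs.trans hqle)
  have hxnorm : (∑' i, ENNReal.ofReal (x₀ i) ^ (d + 1)) ^ (1 / ((d : ℝ) + 1)) ≤
      ENNReal.ofReal r := by
    simp_rw [← ENNReal.ofReal_pow (hx₀0 _)]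
    rw [← ENNReal.ofReal_tsum_of_nonneg (fun i => pow_nonneg (hx₀0 i) _) hx₀sum,
      ENNReal.ofReal_rpow_of_nonneg (tsum_nonneg fun i => pow_nonneg (hx₀0 i) _) (by positivity)]
    exact ENNReal.ofReal_le_ofReal hx₀r
  have hqnorm : (∑' i, ENNReal.ofReal (q i) ^ (((d : ℝ) + 1) / 2)) ^ (2 / ((d : ℝ) + 1)) ≤
      ENNReal.ofReal ((r - r ^ d) / (r ^ (d + 1) + (n : ℝ)) ^ ((d : ℝ) / ((d : ℝ) + 1))) := by
    have hq0' (i : S) : 0 ≤ q i ^ (((d : ℝ) + 1) / 2) := Real.rpow_nonneg (hq0 i) _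
    simp_rw [ENNReal.ofReal_rpow_of_nonneg (hq0 _) (show 0 ≤ ((d : ℝ) + 1) / 2 by positivity)]
    rw [← ENNReal.ofReal_tsum_of_nonneg hq0' hqsum,
      ENNReal.ofReal_rpow_of_nonneg (tsum_nonneg hq0') (by positivity)]
    exact ENNReal.ofReal_le_ofReal hqle
  have hxpow : ∑' i, ENNReal.ofReal (x₀ i) ^ (d + 1) ≤ ENNReal.ofReal (r ^ (d + 1)) := by
    rw [one_div, ENNReal.rpow_inv_le_iff hp] at hxnorm
    rw [ENNReal.ofReal_pow hr.le]
    exact_mod_cast hxnorm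
  have hzpow : ∑' i, ENNReal.ofReal (z i) ^ (d + 1) ≤ ENNReal.ofReal (r ^ (d + 1) + n) := by
    have hle (i : S) : ENNReal.ofReal (z i) ^ (d + 1) ≤
        ENNReal.ofReal (x₀ i) ^ (d + 1) + if i ∈ A then 1 else 0 := by
      by_cases hi : i ∈ A
      · have : ENNReal.ofReal (z i) ^ (d + 1) ≤ 1 :=
          pow_le_one' (by simpa [z, hi] using (hx₁ i hi).2) _
        simpa [hi] using this.trans le_add_self
      · simp [z, hi]
    calc _ ≤ _ := ENNReal.tsum_le_tsum hle
      _ ≤ ENNReal.ofReal (r ^ (d + 1)) + n := by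
          rw [ENNReal.tsum_add]
          gcongr
          rw [tsum_eq_sum (s := A) (fun i hi => by simp [hi]), Finset.sum_ite_mem]
          simp [hcard]
      _ = _ := by rw [ENNReal.ofReal_add (by positivity) (by positivity), ENNReal.ofReal_natCast]
  have hFnorm : (∑' i, ENNReal.ofReal (F i) ^ (d + 1)) ^ (1 / ((d : ℝ) + 1)) ≤
      ENNReal.ofReal r := by
    calc _ ≤ _ := ENNReal.rpow_le_rpow
            (ENNReal.tsum_le_tsum fun i => pow_le_pow_left' (hFle i) _) (by positivity)
      _ ≤ _ := ENNReal.tsum_pow_add_conv_rpow_le hd (fun i => ENNReal.ofReal (q i))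
            (fun i => ENNReal.ofReal (x₀ i)) (fun i => ENNReal.ofReal (z i))
      _ ≤ ENNReal.ofReal r ^ d +
          ENNReal.ofReal ((r - r ^ d) / (r ^ (d + 1) + (n : ℝ)) ^ ((d : ℝ) / ((d : ℝ) + 1))) *
            ENNReal.ofReal (r ^ (d + 1) + n) ^ ((d : ℝ) / ((d : ℝ) + 1)) := by
          gcongr
      _ = ENNReal.ofReal r := by
          rw [ENNReal.ofReal_rpow_of_nonneg (by positivity) (by positivity),
            ← ENNReal.ofReal_mul (div_nonneg hrd (by positivity)),
            div_mul_cancel₀ _ (by positivity), ← ENNReal.ofReal_pow hr.le,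
            ← ENNReal.ofReal_add (by positivity) hrd, add_sub_cancel]
  have hFp0 (i : S) : 0 ≤ F i ^ (d + 1) := pow_nonneg (hF0 i) _
  simp_rw [← ENNReal.ofReal_pow (hF0 _)] at hFnorm
  have hFsum : Summable fun i => F i ^ (d + 1) := by
    have hfin : ∑' i, ENNReal.ofReal (F i ^ (d + 1)) ≠ ⊤ := fun htop => by
      rw [htop, ENNReal.top_rpow_of_pos (by positivity)] at hFnorm
      exact ENNReal.ofReal_ne_top (top_le_iff.1 hFnorm)
    simpa [ENNReal.toReal_ofReal, hFp0] using ENNReal.summable_toReal hfin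
  refine ⟨hF0, hFsum, ?_⟩
  rwa [← ENNReal.ofReal_tsum_of_nonneg hFp0 hFsum,
    ENNReal.ofReal_rpow_of_nonneg (tsum_nonneg hFp0) (by positivity),
    ENNReal.ofReal_le_ofReal_iff hr.le] at hFnorm
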